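/- Suppose 0 ≤ γ₃ ≤ γ₁ ≤ γ₂ and γ₁ > 0. Then the one-way relaying bound B = (C(γ₁+γ₃)·C((√γ₂+√γ₃)²) − C(γ₃)²)/(C(γ₁+γ₃) + C((√γ₂+√γ₃)²) − 2C(γ₃)) is well-defined (the denominator is positive) and satisfies B ≥ C(γ₃), where C(x) = log₂(1+x). -/

import Mathlib

/-- The one-way relaying bound is well-defined and at least the direct-link
capacity C(γ₃). -/
theorem oneway_bound_wellposed (γ₁ γ₂ γ₃ : ℝ)
    (h3 : 0 ≤ γ₃) (h31 : γ₃ ≤ γ₁) (h12 : γ₁ ≤ γ₂) (h1 : 0 < γ₁)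
    (C : ℝ → ℝ) (hC : C = fun x => Real.logb 2 (1 + x)) :
    0 < C (γ₁ + γ₃) + C ((Real.sqrt γ₂ + Real.sqrt γ₃) ^ 2) - 2 * C γ₃ ∧
    C γ₃ ≤ (C (γ₁ + γ₃) * C ((Real.sqrt γ₂ + Real.sqrt γ₃) ^ 2) - C γ₃ ^ 2) /
      (C (γ₁ + γ₃) + C ((Real.sqrt γ₂ + Real.sqrt γ₃) ^ 2) - 2 * C γ₃) := by
  have mono : ∀ y, γ₃ < y → C γ₃ < C y := by
    intro y hy
    rw [hC]
    exact Real.logb_lt_logb (by norm_num) (by linarith) (by linarith)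
  have ha := mono (γ₁ + γ₃) (by linarith)
  have hb := mono ((Real.sqrt γ₂ + Real.sqrt γ₃) ^ 2) (by
    have e2 := Real.sq_sqrt (show 0 ≤ γ₂ by linarith)
    have e3 := Real.sq_sqrt h3
    have p := mul_nonneg (Real.sqrt_nonneg γ₂) (Real.sqrt_nonneg γ₃)
    nlinarith)
  generalize C (γ₁ + γ₃) = a at *
  generalize C ((Real.sqrt γ₂ + Real.sqrt γ₃) ^ 2) = b at *
  have hD : 0 < a + b - 2 * C γ₃ := by linarith
  refine ⟨hD, ?_⟩
  rw [le_div_iff₀ hD]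
  nlinarith [mul_pos (sub_pos.2 ha) (sub_pos.2 hb)]
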